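/- arXiv:2201.05204 — 2 statements merged into one kernel-verified Lean document; each statement's English description precedes it below -/
import Mathlib

section
/- Let a, b ∈ ℝ and let τ be a real random variable uniformly distributed in [−λ,λ] with λ > 0. Then 2λ·P(sign(a+τ) ≠ sign(b+τ)) = |a−b|·1_{|a|≤λ, |b|≤λ} + 2λ·1_{a>λ, b<−λ} + 2λ·1_{a<−λ, b>λ} + (λ−a)·1_{b>λ, |a|≤λ} + (λ−b)·1_{a>λ, |b|≤λ} + (λ+a)·1_{b<−λ, |a|≤λ} + (λ+b)·1_{a<−λ, |b|≤λ}. -/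
open MeasureTheory ProbabilityTheory Real

noncomputable section

/-- sign function with values in {-1,1}. -/
def signPM (s : ℝ) : ℝ := if 0 ≤ s then 1 else -1

/-- uniform distribution on the interval [-λ,λ]. -/
def unifIcc (lam : ℝ) : Measure ℝ :=
  (ENNReal.ofReal (2 * lam))⁻¹ • volume.restrict (Set.Icc (-lam) lam)

/-- real-valued indicator of a decidable condition. -/
def ind (P : Prop) [Decidable P] : ℝ := if P then 1 else 0

/-- The shifts at which `a` and `b` are separated form a half-open interval. -/
theorem setOf_signPM_ne (a b : ℝ) :
    {t | signPM (a + t) ≠ signPM (b + t)} = Set.Ico (-max a b) (-min a b) := by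
  ext t
  simp only [signPM, Set.mem_ofPred_eq, Set.mem_Ico]
  rcases le_total a b with h | h <;> simp only [h, max_eq_left, max_eq_right, min_eq_left,
    min_eq_right] <;> split_ifs <;> constructor <;> intro h' <;>
    first
    | exact absurd rfl h'
    | (constructor <;> linarith)
    | (exfalso; linarith [h'.1, h'.2])
    | norm_num

/-- The measure assigned by `unifIcc` to a half-open interval. -/
theorem two_mul_unifIcc_Ico_toReal {lam : ℝ} (hlam : 0 < lam) (x y : ℝ) :
    2 * lam * (unifIcc lam (Set.Ico x y)).toReal = max (min y lam - max x (-lam)) 0 := by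
  have h : volume (Set.Ico x y ∩ Set.Icc (-lam) lam)
      = volume (Set.Icc x y ∩ Set.Icc (-lam) lam) :=
    measure_congr (Ico_ae_eq_Icc.inter (ae_eq_refl _))
  rw [unifIcc, Measure.smul_apply, Measure.restrict_apply measurableSet_Ico, h,
    Set.Icc_inter_Icc, Real.volume_Icc, smul_eq_mul, ENNReal.toReal_mul, ENNReal.toReal_inv,
    ENNReal.toReal_ofReal (by positivity), ENNReal.toReal_ofReal']
  field_simp

/-- Lemma A.1: exact formula for 2λ·P(sign(a+τ) ≠ sign(b+τ)). -/
theorem two_lam_sep_prob_eq (lam : ℝ) (hlam : 0 < lam) (a b : ℝ) :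
    2 * lam * (unifIcc lam {t | signPM (a + t) ≠ signPM (b + t)}).toReal
      = |a - b| * ind (|a| ≤ lam ∧ |b| ≤ lam)
        + 2 * lam * ind (lam < a ∧ b < -lam)
        + 2 * lam * ind (a < -lam ∧ lam < b)
        + (lam - a) * ind (lam < b ∧ |a| ≤ lam)
        + (lam - b) * ind (lam < a ∧ |b| ≤ lam)
        + (lam + a) * ind (b < -lam ∧ |a| ≤ lam)
        + (lam + b) * ind (a < -lam ∧ |b| ≤ lam) := by
  have trichotomy (x : ℝ) : (lam < x ∧ ¬ x < -lam ∧ ¬ |x| ≤ lam) ∨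
      (¬ lam < x ∧ x < -lam ∧ ¬ |x| ≤ lam) ∨ (¬ lam < x ∧ ¬ x < -lam ∧ |x| ≤ lam) := by
    grind
  rw [setOf_signPM_ne, two_mul_unifIcc_Ico_toReal hlam]
  rcases trichotomy a with ⟨h₁, h₂, h₃⟩ | ⟨h₁, h₂, h₃⟩ | ⟨h₁, h₂, h₃⟩ <;>
  rcases trichotomy b with ⟨k₁, k₂, k₃⟩ | ⟨k₁, k₂, k₃⟩ | ⟨k₁, k₂, k₃⟩ <;>
  simp only [ind, h₁, h₂, h₃, k₁, k₂, k₃, and_self, and_true, and_false, if_true, if_false] <;>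
  grind

end
end

section
/- There is an absolute constant c > 0, and for every β > 0 there is a constant γ = γ(β) ≥ 1, such that the following holds. Let T ⊆ ℝ^n be a convex body, let δ, λ > 0, and assume ℓ_*((T−T) ∩ λB₂ⁿ) > γ·ℓ_*((T−T) ∩ δB₂ⁿ). Let A : ℝ^n → ℝ^m be a standard gaussian matrix and τ uniformly distributed in [−λ,λ]^m, independent of A, and set f(t) = sign(At+τ). If with probability at least 0.9 one has sup_{x,y∈T} | (√(2π)·λ/m)·d_H(f(x),f(y)) − ‖x−y‖₂ | ≤ δ, then β·λ·√m ≥ ℓ_*((T−T) ∩ δB₂ⁿ). -/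
open MeasureTheory ProbabilityTheory Real

noncomputable section

/-- Euclidean norm on `Fin n → ℝ`. -/
def enorm2 {n : ℕ} (x : Fin n → ℝ) : ℝ := Real.sqrt (∑ i, (x i)^2)

/-- Euclidean inner product. -/
def ip {n : ℕ} (x y : Fin n → ℝ) : ℝ := ∑ i, x i * y i

/-- componentwise sign. -/
def signVec {m : ℕ} (v : Fin m → ℝ) : Fin m → ℝ := fun i => signPM (v i)

/-- Hamming distance. -/
def hamming {m : ℕ} (u v : Fin m → ℝ) : ℕ := (Finset.univ.filter fun i => u i ≠ v i).card

def mulVecR {m n : ℕ} (A : Fin m → Fin n → ℝ) (x : Fin n → ℝ) : Fin m → ℝ :=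
  fun i => ∑ j, A i j * x j

def l1norm {m : ℕ} (v : Fin m → ℝ) : ℝ := ∑ i, |v i|

/-- the norm ‖v‖_{[s]}. -/
def knorm {m : ℕ} (s : ℕ) (v : Fin m → ℝ) : ℝ :=
  sSup {r | ∃ I : Finset (Fin m), I.card = s ∧ r = Real.sqrt (∑ i ∈ I, (v i)^2)}

/-- standard gaussian measure on ℝ^n. -/
def gaussianPi (n : ℕ) : Measure (Fin n → ℝ) := Measure.pi fun _ => gaussianReal 0 1

instance (n : ℕ) : IsProbabilityMeasure (gaussianPi n) := by
  unfold gaussianPi; infer_instance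

/-- standard gaussian m × n matrix distribution (rows). -/
def gaussianMatrix (m n : ℕ) : Measure (Fin m → Fin n → ℝ) := Measure.pi fun _ => gaussianPi n

instance (m n : ℕ) : IsProbabilityMeasure (gaussianMatrix m n) := by
  unfold gaussianMatrix; infer_instance

/-- uniform distribution on the cube [-λ,λ]^m. -/
def unifCube (m : ℕ) (lam : ℝ) : Measure (Fin m → ℝ) :=
  (ENNReal.ofReal ((2*lam)^m))⁻¹ • volume.restrict (Set.univ.pi fun _ => Set.Icc (-lam) lam)

instance (m : ℕ) (lam : ℝ) : SFinite (unifCube m lam) := by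
  unfold unifCube; infer_instance

/-- gaussian mean width. -/
def meanWidth {n : ℕ} (T : Set (Fin n → ℝ)) : ℝ :=
  ∫ g, sSup ((fun t => |ip g t|) '' T) ∂(gaussianPi n)

/-- Dvoretzky–Milman dimension. -/
def dstar {n : ℕ} (T : Set (Fin n → ℝ)) : ℝ :=
  (meanWidth T / sSup (enorm2 '' T))^2

/-- covering number. -/
def coveringNumber {n : ℕ} (T : Set (Fin n → ℝ)) (θ : ℝ) : ℕ :=
  sInf {N : ℕ | ∃ F : Finset (Fin n → ℝ), F.card = N ∧ T ⊆ ⋃ c ∈ F, {x | enorm2 (x - c) < θ}}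

/-- the difference set T - T. -/
def diffSet {n : ℕ} (T : Set (Fin n → ℝ)) : Set (Fin n → ℝ) :=
  {z | ∃ a ∈ T, ∃ b ∈ T, z = a - b}

/-- closed euclidean ball of radius r. -/
def ballE (n : ℕ) (r : ℝ) : Set (Fin n → ℝ) := {z | enorm2 z ≤ r}

/-- The product of Gaussian measures is Gaussian. -/
instance isGaussian_measure_pi {ι : Type*} [Fintype ι] {E : ι → Type*}
    [∀ i, NormedAddCommGroup (E i)] [∀ i, NormedSpace ℝ (E i)] [∀ i, MeasurableSpace (E i)]
    [∀ i, CompleteSpace (E i)] [∀ i, BorelSpace (E i)] [∀ i, SecondCountableTopology (E i)]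
    (μ : ∀ i, Measure (E i)) [∀ i, IsGaussian (μ i)] : IsGaussian (Measure.pi μ) := by
  have h : iIndepFun (fun i (ω : ∀ i, E i) => ω i) (Measure.pi μ) :=
    iIndepFun_pi (X := fun i (x : E i) => x) fun i => aemeasurable_id
  have h2 := (h.hasGaussianLaw fun i => by
    have := (measurePreserving_eval μ i).map_eq
    exact ⟨by change IsGaussian ((Measure.pi μ).map (Function.eval i)); rw [this]; infer_instance⟩)
  simpa using h2.isGaussian_map

instance isGaussian_gaussianPi (n : ℕ) : IsGaussian (gaussianPi n) := by
  unfold gaussianPi; infer_instance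

instance isGaussian_gaussianMatrix (m n : ℕ) : IsGaussian (gaussianMatrix m n) := by
  unfold gaussianMatrix; infer_instance

lemma integral_id_gaussianPi (n : ℕ) : (gaussianPi n)[id] = 0 := by
  have h : Integrable (id : (Fin n → ℝ) → _) (gaussianPi n) := IsGaussian.integrable_id
  ext i
  have h1 := ContinuousLinearMap.integral_comp_comm (ContinuousLinearMap.proj (R := ℝ) i) h
  simp only [ContinuousLinearMap.proj_apply] at h1
  rw [← h1]
  have := integral_comp_eval (μ := fun _ : Fin n => gaussianReal 0 1) (i := i)
    (f := fun x : ℝ => x) (by fun_prop)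
  simpa [gaussianPi] using this

section Seminorm

variable {E : Type*} [NormedAddCommGroup E] [NormedSpace ℝ E] [SecondCountableTopology E]
  [CompleteSpace E] [MeasurableSpace E] [BorelSpace E] {μ : Measure E}

/-- Any continuous seminorm is integrable with respect to a Gaussian measure. -/
lemma integrable_seminorm [IsGaussian μ] (p : Seminorm ℝ E) (hp : Continuous p) :
    Integrable (fun x => p x) μ := by
  obtain ⟨C, -, hC⟩ := Seminorm.bound_of_continuous_normedSpace p hp
  refine Integrable.mono' ((IsGaussian.integrable_id (μ := μ)).norm.const_mul C)
    hp.aestronglyMeasurable (ae_of_all _ fun x => ?_)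
  rw [Real.norm_of_nonneg (apply_nonneg p x)]
  exact hC x

/-- A quantitative Fernique-type bound: if a seminorm of a centred Gaussian vector is at most `s`
with probability at least `0.8`, then its expectation is at most `4 * s`. -/
lemma integral_seminorm_le [IsGaussian μ] (hμ : μ[id] = 0) (p : Seminorm ℝ E) (hp : Continuous p)
    {s : ℝ} (hs : 0 ≤ s) (h : 0.8 ≤ μ.real {x | p x ≤ s}) : ∫ x, p x ∂μ ≤ 4 * s := by
  have hint := integrable_seminorm (μ := μ) p hp
  set B : Set E := {x | p x ≤ s} with hB
  have hBm : MeasurableSet B := (isClosed_le hp continuous_const).measurableSet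
  set φ : E → ℝ := fun x => max (p x - s) 0 with hφ
  have hφi : Integrable φ μ := (hint.sub (integrable_const s)).pos_part
  have hφ0 : ∀ x, 0 ≤ φ x := fun x => le_max_right _ _
  have hI0 : 0 ≤ ∫ x, φ x ∂μ := integral_nonneg hφ0
  have h1i : ∀ C : Set E, MeasurableSet C → Integrable (C.indicator (1 : E → ℝ)) μ := fun C hC =>
    (integrable_const (1 : ℝ)).indicator hC
  have hsqrt : (0 : ℝ) < √2 := by positivity
  have hmin : Integrable (fun z : E × E => min (p z.1) (p z.2)) (μ.prod μ) :=
    (hint.comp_fst μ).inf (hint.comp_snd μ)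
  have hrotm : Measurable (ContinuousLinearMap.rotation (E := E) (π / 4)) :=
    (ContinuousLinearMap.rotation (E := E) (π / 4)).continuous.measurable
  have hmp : MeasurePreserving (ContinuousLinearMap.rotation (E := E) (π / 4))
      (μ.prod μ) (μ.prod μ) := ⟨hrotm, IsGaussian.map_rotation_eq_self hμ _⟩
  have hrot : ∫ z, min (p (ContinuousLinearMap.rotation (π / 4) z).1)
      (p (ContinuousLinearMap.rotation (π / 4) z).2) ∂(μ.prod μ)
      = ∫ z, min (p z.1) (p z.2) ∂(μ.prod μ) := by
    conv_rhs => rw [← IsGaussian.map_rotation_eq_self hμ (π / 4)]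
    rw [integral_map hrotm.aemeasurable]
    exact ((hp.comp continuous_fst).min (hp.comp continuous_snd)).aestronglyMeasurable
  have hmini : Integrable (fun z : E × E => min (p (ContinuousLinearMap.rotation (π / 4) z).1)
      (p (ContinuousLinearMap.rotation (π / 4) z).2)) (μ.prod μ) :=
    hmp.integrable_comp_of_integrable hmin
  have hpt : ∀ x y : E, φ x * B.indicator 1 y ≤ √2 *
      min (p (ContinuousLinearMap.rotation (π / 4) (x, y)).1)
        (p (ContinuousLinearMap.rotation (π / 4) (x, y)).2) := by
    intro x y
    rw [ContinuousLinearMap.rotation_apply]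
    simp only [Real.cos_pi_div_four, Real.sin_pi_div_four]
    by_cases hy : y ∈ B
    · have key : ∀ u : E, ∀ ε : ℝ, |ε| = 1 → x = √2 • u + ε • y → φ x ≤ √2 * p u := by
        intro u ε hε hx
        have h1 : p x ≤ √2 * p u + p y := by
          calc p x = p (√2 • u + ε • y) := by rw [← hx]
            _ ≤ _ := map_add_le_add p _ _
            _ = _ := by
              rw [map_smul_eq_mul, map_smul_eq_mul, Real.norm_eq_abs, Real.norm_eq_abs, hε,
                abs_of_pos hsqrt, one_mul]
        have h2 : p y ≤ s := hy
        exact max_le (by linarith) (mul_nonneg hsqrt.le (apply_nonneg p u))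
      have e : √2 * (√2 / 2) = 1 := by
        rw [← mul_div_assoc, Real.mul_self_sqrt (by norm_num)]; norm_num
      simp only [Set.indicator_of_mem hy, Pi.one_apply, mul_one]
      rw [mul_min_of_nonneg _ _ hsqrt.le]
      refine le_min (key _ (-1) (by simp) ?_) ?_
      · rw [smul_add, smul_smul, smul_smul, e]; module
      · have h3 : p (-(√2 / 2) • x + (√2 / 2) • y) = p ((√2 / 2) • x - (√2 / 2) • y) := by
          rw [← map_neg_eq_map p]; congr 1; module
        rw [h3]
        refine key _ 1 (by simp) ?_
        rw [smul_sub, smul_smul, smul_smul, e]; module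
    · simp only [Set.indicator_of_notMem hy, mul_zero]
      positivity
  have hpt2 : ∀ x y : E, min (p x) (p y) ≤ s + φ x * Bᶜ.indicator 1 y := by
    intro x y
    by_cases hy : y ∈ B
    · have : p y ≤ s := hy
      simp [hy, this]
    · have : p x - s ≤ φ x := le_max_left _ _
      have : p x ≤ s + φ x := by linarith
      simp [hy, this]
  have e1 : ∫ z : E × E, φ z.1 * B.indicator 1 z.2 ∂(μ.prod μ) = (∫ x, φ x ∂μ) * μ.real B := by
    rw [integral_prod_mul φ (B.indicator (1 : E → ℝ)), integral_indicator_one hBm]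
  have e2 : ∫ z : E × E, (s + φ z.1 * Bᶜ.indicator 1 z.2) ∂(μ.prod μ)
      = s + (∫ x, φ x ∂μ) * μ.real Bᶜ := by
    rw [integral_add (integrable_const s) (hφi.mul_prod (h1i _ hBm.compl)),
      integral_prod_mul φ (Bᶜ.indicator (1 : E → ℝ)), integral_indicator_one hBm.compl]
    simp
  have l1 : (∫ x, φ x ∂μ) * μ.real B ≤ √2 * ∫ z, min (p z.1) (p z.2) ∂(μ.prod μ) := by
    rw [← e1, ← hrot, ← integral_const_mul]
    exact integral_mono (hφi.mul_prod (h1i _ hBm)) (hmini.const_mul _) fun z => hpt z.1 z.2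
  have l2 : ∫ z, min (p z.1) (p z.2) ∂(μ.prod μ) ≤ s + (∫ x, φ x ∂μ) * μ.real Bᶜ := by
    rw [← e2]
    exact integral_mono hmin ((integrable_const s).add (hφi.mul_prod (h1i _ hBm.compl)))
      fun z => hpt2 z.1 z.2
  have hc : μ.real Bᶜ = 1 - μ.real B := probReal_compl_eq_one_sub hBm
  have l3 : ∫ x, p x ∂μ ≤ s + ∫ x, φ x ∂μ := by
    calc ∫ x, p x ∂μ ≤ ∫ x, (s + φ x) ∂μ :=
          integral_mono hint ((integrable_const s).add hφi) fun x => by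
            have : p x - s ≤ φ x := le_max_left _ _
            change p x ≤ s + φ x
            linarith
      _ = _ := by rw [integral_add (integrable_const s) hφi]; simp
  have h15 : √2 ≤ 1.5 := by
    rw [Real.sqrt_le_left (by norm_num)]; norm_num
  have l4 : ∫ z, min (p z.1) (p z.2) ∂(μ.prod μ) ≤ s + (∫ x, φ x ∂μ) * 0.2 := by
    refine l2.trans ?_
    gcongr
    rw [hc]; linarith
  have l5 : √2 * ∫ z, min (p z.1) (p z.2) ∂(μ.prod μ) ≤ 1.5 * (s + (∫ x, φ x ∂μ) * 0.2) := by
    have : 0 ≤ s + (∫ x, φ x ∂μ) * 0.2 := by positivity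
    calc _ ≤ √2 * (s + (∫ x, φ x ∂μ) * 0.2) := by gcongr
      _ ≤ _ := by gcongr
  have l6 : (∫ x, φ x ∂μ) * 0.8 ≤ (∫ x, φ x ∂μ) * μ.real B := by gcongr
  linarith

end Seminorm

section Width

variable {n : ℕ} {V : Set (Fin n → ℝ)} {r : ℝ}

lemma abs_apply_le_enorm2 (t : Fin n → ℝ) (i : Fin n) : |t i| ≤ enorm2 t := by
  rw [enorm2, ← Real.sqrt_sq_eq_abs]
  exact Real.sqrt_le_sqrt (Finset.single_le_sum (f := fun i => t i ^ 2)
    (fun j _ => sq_nonneg _) (Finset.mem_univ i))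

lemma bddAbove_abs_ip (hV : ∀ t ∈ V, enorm2 t ≤ r) (g : Fin n → ℝ) :
    BddAbove ((fun t => |ip g t|) '' V) := by
  refine ⟨∑ i, |g i| * r, ?_⟩
  rintro _ ⟨t, ht, rfl⟩
  refine (Finset.abs_sum_le_sum_abs _ _).trans (Finset.sum_le_sum fun i _ => ?_)
  rw [abs_mul]
  exact mul_le_mul_of_nonneg_left ((abs_apply_le_enorm2 t i).trans (hV t ht)) (abs_nonneg _)

lemma ip_add (g g' t : Fin n → ℝ) : ip (g + g') t = ip g t + ip g' t := by
  simp [ip, add_mul, Finset.sum_add_distrib]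

lemma ip_smul (a : ℝ) (g t : Fin n → ℝ) : ip (a • g) t = a * ip g t := by
  simp [ip, Finset.mul_sum, mul_assoc]

lemma ip_smul_right (a : ℝ) (g t : Fin n → ℝ) : ip g (a • t) = a * ip g t := by
  simp only [ip, Finset.mul_sum, Pi.smul_apply, smul_eq_mul]
  exact Finset.sum_congr rfl fun i _ => by ring

/-- The support function of a nonempty bounded set, as a seminorm. -/
def widthSeminorm (V : Set (Fin n → ℝ)) (hne : V.Nonempty) (hV : ∀ t ∈ V, enorm2 t ≤ r) :
    Seminorm ℝ (Fin n → ℝ) :=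
  Seminorm.ofSMulLE (fun g => sSup ((fun t => |ip g t|) '' V))
    (by
      have : (fun t => |ip (0 : Fin n → ℝ) t|) = fun _ => (0 : ℝ) := by
        ext t; simp [ip]
      simp only [this, hne.image_const, csSup_singleton])
    (fun x y => by
      refine csSup_le (hne.image _) ?_
      rintro _ ⟨t, ht, rfl⟩
      simp only [ip_add]
      exact (abs_add_le _ _).trans (add_le_add
        (le_csSup (bddAbove_abs_ip hV x) ⟨t, ht, rfl⟩)
        (le_csSup (bddAbove_abs_ip hV y) ⟨t, ht, rfl⟩)))
    (fun a x => by
      refine csSup_le (hne.image _) ?_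
      rintro _ ⟨t, ht, rfl⟩
      simp only [ip_smul, abs_mul, Real.norm_eq_abs]
      exact mul_le_mul_of_nonneg_left (le_csSup (bddAbove_abs_ip hV x) ⟨t, ht, rfl⟩)
        (abs_nonneg _))

lemma seminorm_continuous_of_finiteDimensional {E : Type*} [NormedAddCommGroup E]
    [NormedSpace ℝ E] [FiniteDimensional ℝ E] (p : Seminorm ℝ E) : Continuous p :=
  continuousOn_univ.1 (p.convexOn.continuousOn isOpen_univ)

lemma meanWidth_eq_integral (hne : V.Nonempty) (hV : ∀ t ∈ V, enorm2 t ≤ r) :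
    meanWidth V = ∫ g, widthSeminorm V hne hV g ∂(gaussianPi n) := rfl

lemma meanWidth_nonneg (hne : V.Nonempty) (hV : ∀ t ∈ V, enorm2 t ≤ r) : 0 ≤ meanWidth V :=
  integral_nonneg fun g => apply_nonneg (widthSeminorm V hne hV) g

lemma meanWidth_mono {W : Set (Fin n → ℝ)} (hne : V.Nonempty) (hW : ∀ t ∈ W, enorm2 t ≤ r)
    (h : V ⊆ W) : meanWidth V ≤ meanWidth W := by
  have hV : ∀ t ∈ V, enorm2 t ≤ r := fun t ht => hW t (h ht)
  rw [meanWidth_eq_integral hne hV, meanWidth_eq_integral (hne.mono h) hW]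
  refine integral_mono (integrable_seminorm _ (seminorm_continuous_of_finiteDimensional _))
    (integrable_seminorm _ (seminorm_continuous_of_finiteDimensional _)) fun g => ?_
  exact csSup_le_csSup (bddAbove_abs_ip hW g) (hne.image _) (Set.image_mono h)

lemma continuous_abs_ip (g : Fin n → ℝ) : Continuous fun t => |ip g t| := by
  unfold ip; fun_prop

/-- If the mean width exceeds `4 * s`, countably many points of `V` witness a width larger than `s`
with probability at least `0.2`. -/
lemma exists_seq_measure_ge (hne : V.Nonempty) (hV : ∀ t ∈ V, enorm2 t ≤ r) {s : ℝ} (hs : 0 ≤ s)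
    (h : 4 * s < meanWidth V) : ∃ z : ℕ → Fin n → ℝ, (∀ k, z k ∈ V) ∧
      0.2 ≤ (gaussianPi n).real (⋃ k, {g | s < |ip g (z k)|}) := by
  have := hne.to_subtype
  refine ⟨fun k => (TopologicalSpace.denseSeq V k : Fin n → ℝ), fun k => Subtype.prop _, ?_⟩
  set p := widthSeminorm V hne hV
  have hp : Continuous p := seminorm_continuous_of_finiteDimensional _
  have hlt : (gaussianPi n).real {g | p g ≤ s} < 0.8 := by
    by_contra! hcon
    exact absurd (integral_seminorm_le (integral_id_gaussianPi n) p hp hs hcon) (not_le.2 h)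
  have hm : MeasurableSet {g | p g ≤ s} := (isClosed_le hp continuous_const).measurableSet
  have hc := probReal_compl_eq_one_sub (μ := gaussianPi n) hm
  refine (by linarith : (0.2 : ℝ) ≤ (gaussianPi n).real {g | p g ≤ s}ᶜ).trans
    (measureReal_mono fun g hg => ?_)
  simp only [Set.mem_compl_iff, Set.mem_ofPred_eq, not_le] at hg
  obtain ⟨_, ⟨t, ht, rfl⟩, hst⟩ := exists_lt_of_lt_csSup (hne.image _) hg
  have hopen : IsOpen {u : V | s < |ip g (u : Fin n → ℝ)|} :=
    isOpen_lt continuous_const ((continuous_abs_ip g).comp continuous_subtype_val)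
  obtain ⟨k, hk⟩ := (TopologicalSpace.denseRange_denseSeq V).exists_mem_open hopen ⟨⟨t, ht⟩, hst⟩
  exact Set.mem_iUnion.2 ⟨k, hk⟩

end Width

section Matrix

variable {m n : ℕ}

lemma memLp_entry (i : Fin m) (j : Fin n) :
    MemLp (fun A : Fin m → Fin n → ℝ => A i j) 2 (gaussianMatrix m n) :=
  ((IsGaussian.hasGaussianLaw_id (μ := gaussianMatrix m n)).map_fun
    ((ContinuousLinearMap.proj (R := ℝ) (φ := fun _ : Fin n => ℝ) j).comp
      (ContinuousLinearMap.proj (φ := fun _ : Fin m => Fin n → ℝ) i))).memLp_two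

lemma measurePreserving_entry (i : Fin m) (j : Fin n) :
    MeasurePreserving (fun A : Fin m → Fin n → ℝ => A i j) (gaussianMatrix m n)
      (gaussianReal 0 1) :=
  (measurePreserving_eval (fun _ : Fin n => gaussianReal 0 1) j).comp
    (measurePreserving_eval (fun _ : Fin m => gaussianPi n) i)

lemma integral_entry (i : Fin m) (j : Fin n) :
    ∫ A : Fin m → Fin n → ℝ, A i j ∂(gaussianMatrix m n) = 0 := by
  have h := (measurePreserving_entry i j).map_eq
  have h2 := integral_map (μ := gaussianMatrix m n) (measurePreserving_entry i j).aemeasurable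
    (f := fun x : ℝ => x) (by fun_prop)
  rw [← h2, h]
  simp

lemma covariance_entry (i k : Fin m) (j l : Fin n) :
    cov[fun A : Fin m → Fin n → ℝ => A i j, fun A => A k l; gaussianMatrix m n]
      = if i = k ∧ j = l then 1 else 0 := by
  by_cases hik : i = k
  · subst hik
    by_cases hjl : j = l
    · subst hjl
      rw [covariance_self (measurePreserving_entry i j).aemeasurable]
      have := variance_map (μ := gaussianMatrix m n) (X := fun x : ℝ => x)
        (by fun_prop) (measurePreserving_entry i j).aemeasurable
      rw [(measurePreserving_entry i j).map_eq] at this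
      simp only [and_self, if_true]
      rw [Function.comp_def] at this
      rw [← this]
      simp
    · have hind : iIndepFun (fun (j : Fin n) (g : Fin n → ℝ) => g j) (gaussianPi n) :=
        iIndepFun_pi (X := fun (_ : Fin n) (x : ℝ) => x) fun _ => aemeasurable_id
      have hmp := measurePreserving_eval (fun _ : Fin m => gaussianPi n) i
      have hL : ∀ j : Fin n, MemLp (fun g : Fin n → ℝ => g j) 2 (gaussianPi n) := fun j =>
        ((IsGaussian.hasGaussianLaw_id (μ := gaussianPi n)).map_fun
          (ContinuousLinearMap.proj (R := ℝ) (φ := fun _ : Fin n => ℝ) j)).memLp_two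
      have h0 := (hind.indepFun hjl).covariance_eq_zero (hL j) (hL l)
      rw [← hmp.map_eq, covariance_map_fun
        (measurable_pi_apply j).aestronglyMeasurable (measurable_pi_apply l).aestronglyMeasurable
        hmp.aemeasurable] at h0
      rw [if_neg (by tauto)]
      exact h0
  · have hind : iIndepFun (fun (i : Fin m) (A : Fin m → Fin n → ℝ) => A i) (gaussianMatrix m n) :=
      iIndepFun_pi (X := fun (_ : Fin m) (x : Fin n → ℝ) => x) fun _ => aemeasurable_id
    have hI := (hind.indepFun hik).comp (measurable_pi_apply j) (measurable_pi_apply l)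
    have := hI.covariance_eq_zero (memLp_entry i j) (memLp_entry k l)
    rw [if_neg (by tauto)]
    exact this

/-- The linear functional of a matrix with coefficients `M`. -/
def entrySum (M : Fin m × Fin n → ℝ) : (Fin m → Fin n → ℝ) →L[ℝ] ℝ :=
  ∑ p, M p • ((ContinuousLinearMap.proj (R := ℝ) (φ := fun _ : Fin n => ℝ) p.2).comp
      (ContinuousLinearMap.proj (φ := fun _ : Fin m => Fin n → ℝ) p.1))

lemma entrySum_apply (M : Fin m × Fin n → ℝ) (A : Fin m → Fin n → ℝ) :
    entrySum M A = ∑ p, M p * A p.1 p.2 := by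
  simp [entrySum]

lemma covariance_entrySum (M N : Fin m × Fin n → ℝ) :
    cov[entrySum M, entrySum N; gaussianMatrix m n] = ∑ p, M p * N p := by
  have e : ∀ M : Fin m × Fin n → ℝ, (entrySum M : (Fin m → Fin n → ℝ) → ℝ) =
      fun A => ∑ p, M p * A p.1 p.2 := fun M => funext (entrySum_apply M)
  rw [e M, e N, covariance_fun_sum_fun_sum
    (X := fun (p : Fin m × Fin n) (A : Fin m → Fin n → ℝ) => M p * A p.1 p.2)
    (Y := fun (p : Fin m × Fin n) (A : Fin m → Fin n → ℝ) => N p * A p.1 p.2)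
    (fun p => (memLp_entry p.1 p.2).const_mul _) (fun p => (memLp_entry p.1 p.2).const_mul _)]
  refine Finset.sum_congr rfl fun p _ => ?_
  simp_rw [covariance_const_mul_left, covariance_const_mul_right, covariance_entry,
    ← Prod.ext_iff]
  simp

lemma integral_entrySum (M : Fin m × Fin n → ℝ) :
    ∫ A, entrySum M A ∂(gaussianMatrix m n) = 0 := by
  simp_rw [entrySum_apply]
  rw [integral_finsetSum _ fun p _ => ((memLp_entry p.1 p.2).integrable one_le_two).const_mul _]
  simp [integral_const_mul, integral_entry]

lemma hasGaussianLaw_entrySum (M : Fin m × Fin n → ℝ) :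
    HasGaussianLaw (entrySum M) (gaussianMatrix m n) :=
  (IsGaussian.hasGaussianLaw_id (μ := gaussianMatrix m n)).map_fun (entrySum M)

/-- The normalized sum of the rows of a matrix. -/
def rowSum (A : Fin m → Fin n → ℝ) : Fin n → ℝ := fun j => (√m)⁻¹ * ∑ i, A i j

/-- The coefficients of the `j`-th coordinate of `rowSum`. -/
def rowSumCoeff (m : ℕ) (j : Fin n) : Fin m × Fin n → ℝ :=
  fun p => if p.2 = j then (√m)⁻¹ else 0

/-- The coefficients of the deviation of `⟨A i, z⟩` from its average over the rows. -/
def devCoeff (i : Fin m) (z : Fin n → ℝ) : Fin m × Fin n → ℝ :=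
  fun p => ((if p.1 = i then 1 else 0) - (m : ℝ)⁻¹) * z p.2

lemma entrySum_rowSumCoeff (j : Fin n) (A : Fin m → Fin n → ℝ) :
    entrySum (rowSumCoeff m j) A = rowSum A j := by
  simp [entrySum_apply, rowSumCoeff, rowSum, Fintype.sum_prod_type, Finset.mul_sum]

lemma entrySum_devCoeff (i : Fin m) (z : Fin n → ℝ) (A : Fin m → Fin n → ℝ) :
    entrySum (devCoeff i z) A = ip (A i) z - (√m)⁻¹ * ip (rowSum A) z := by
  have hm : (√m)⁻¹ * (√m)⁻¹ = (m : ℝ)⁻¹ := by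
    rw [← mul_inv, Real.mul_self_sqrt (Nat.cast_nonneg m)]
  simp only [entrySum_apply, devCoeff, ip, rowSum, Fintype.sum_prod_type, sub_mul,
    Finset.sum_sub_distrib]
  congr 1
  · rw [Finset.sum_eq_single i (fun b _ hb => by simp [hb]) (by simp)]
    simp [mul_comm]
  · rw [Finset.sum_comm, Finset.mul_sum]
    refine Finset.sum_congr rfl fun j _ => ?_
    rw [← hm, Finset.mul_sum, Finset.sum_mul, Finset.mul_sum]
    exact Finset.sum_congr rfl fun k _ => by ring

lemma map_rowSum (hm : m ≠ 0) : (gaussianMatrix m n).map rowSum = gaussianPi n := by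
  have hm' : (0 : ℝ) < m := by positivity
  have hmm : (√m)⁻¹ * (√m)⁻¹ = (m : ℝ)⁻¹ := by
    rw [← mul_inv, Real.mul_self_sqrt hm'.le]
  have hcov : ∀ j l : Fin n, cov[entrySum (rowSumCoeff m j), entrySum (rowSumCoeff m l);
      gaussianMatrix m n] = if j = l then 1 else 0 := by
    intro j l
    rw [covariance_entrySum]
    by_cases h : j = l
    · subst h
      simp [rowSumCoeff, Fintype.sum_prod_type, hmm, hm]
    · simp [rowSumCoeff, Fintype.sum_prod_type, h, Ne.symm h]
  have hG : HasGaussianLaw (fun A (j : Fin n) => entrySum (rowSumCoeff m j) A)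
      (gaussianMatrix m n) :=
    (IsGaussian.hasGaussianLaw_id (μ := gaussianMatrix m n)).map_fun
      (ContinuousLinearMap.pi fun j : Fin n => entrySum (rowSumCoeff m j))
  have hind := hG.iIndepFun_of_covariance_eq_zero fun j l hjl => by rw [hcov, if_neg hjl]
  rw [iIndepFun_iff_map_fun_eq_pi_map (by fun_prop)] at hind
  have e : (rowSum : (Fin m → Fin n → ℝ) → _) = fun A j => entrySum (rowSumCoeff m j) A := by
    ext A j; rw [entrySum_rowSumCoeff]
  rw [e, hind, gaussianPi]
  congr 1
  ext1 j
  rw [(hasGaussianLaw_entrySum _).map_eq_gaussianReal, integral_entrySum,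
    ← covariance_self (hasGaussianLaw_entrySum _).aemeasurable, hcov]
  simp

lemma indepFun_rowSum_dev (hm : m ≠ 0) (i : Fin m) (z : Fin n → ℝ) :
    IndepFun rowSum (entrySum (devCoeff i z)) (gaussianMatrix m n) := by
  have hG : HasGaussianLaw (fun A => (fun (j : Fin n) => entrySum (rowSumCoeff m j) A,
      fun _ : Unit => entrySum (devCoeff i z) A)) (gaussianMatrix m n) :=
    (IsGaussian.hasGaussianLaw_id (μ := gaussianMatrix m n)).map_fun
      ((ContinuousLinearMap.pi fun j : Fin n => entrySum (rowSumCoeff m j)).prod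
        (ContinuousLinearMap.pi fun _ : Unit => entrySum (devCoeff i z)))
  have h := hG.indepFun_of_covariance_eval (X := fun j A => entrySum (rowSumCoeff m j) A)
    (Y := fun _ A => entrySum (devCoeff i z) A) fun j _ => by
      change cov[entrySum (rowSumCoeff m j), entrySum (devCoeff i z); gaussianMatrix m n] = 0
      rw [covariance_entrySum]
      simp only [rowSumCoeff, devCoeff, Fintype.sum_prod_type, ite_mul, zero_mul,
        Finset.sum_ite_eq', Finset.mem_univ, if_true]
      rw [← Finset.mul_sum, ← Finset.sum_mul]
      simp [hm]
  have h2 := h.comp measurable_id (measurable_pi_apply ())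
  have e : (rowSum : (Fin m → Fin n → ℝ) → _) = fun A j => entrySum (rowSumCoeff m j) A := by
    ext A j; rw [entrySum_rowSumCoeff]
  rw [e]
  exact h2

lemma variance_dev_le (hm : m ≠ 0) (i : Fin m) (z : Fin n → ℝ) :
    Var[entrySum (devCoeff i z); gaussianMatrix m n] ≤ enorm2 z ^ 2 := by
  have hz : 0 ≤ ∑ j, z j ^ 2 := Finset.sum_nonneg fun _ _ => sq_nonneg _
  rw [← covariance_self (hasGaussianLaw_entrySum _).aemeasurable, covariance_entrySum, enorm2,
    Real.sq_sqrt hz]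
  have e : ∑ p, devCoeff i z p * devCoeff i z p
      = (∑ k : Fin m, ((if k = i then 1 else 0) - (m : ℝ)⁻¹) ^ 2) * ∑ j, z j ^ 2 := by
    rw [Fintype.sum_prod_type, Finset.sum_mul_sum]
    exact Finset.sum_congr rfl fun k _ => Finset.sum_congr rfl fun j _ => by
      simp only [devCoeff]; ring
  have e2 : ∑ k : Fin m, ((if k = i then 1 else 0) - (m : ℝ)⁻¹) ^ 2 = 1 - (m : ℝ)⁻¹ := by
    simp only [sub_sq, Finset.sum_add_distrib, Finset.sum_sub_distrib, ite_pow]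
    simp only [one_pow, ne_eq, OfNat.ofNat_ne_zero, not_false_eq_true, zero_pow, mul_ite, mul_one,
      mul_zero, ite_mul, zero_mul, Finset.sum_ite_eq', Finset.mem_univ, if_true,
      Finset.sum_const, Finset.card_univ, Fintype.card_fin, nsmul_eq_mul]
    field_simp
    ring
  rw [e, e2]
  have : (0 : ℝ) ≤ (m : ℝ)⁻¹ := by positivity
  nlinarith

end Matrix

section LargeRows

variable {m n : ℕ} {lam : ℝ}

lemma measurable_rowSum : Measurable (rowSum : (Fin m → Fin n → ℝ) → Fin n → ℝ) := by
  unfold rowSum; fun_prop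

lemma continuous_ip (z : Fin n → ℝ) : Continuous fun g => ip g z := by
  unfold ip; fun_prop

lemma measure_dev_ge_le (hm : m ≠ 0) (hlam : 0 < lam) (i : Fin m) {z : Fin n → ℝ}
    (hz : enorm2 z ≤ lam) :
    gaussianMatrix m n {A | 20 * lam ≤ |entrySum (devCoeff i z) A|} ≤ ENNReal.ofReal (1 / 400) := by
  have h := meas_ge_le_variance_div_sq
    (hasGaussianLaw_entrySum (devCoeff i z)).memLp_two (c := 20 * lam) (by positivity)
  simp only [integral_entrySum, sub_zero] at h
  refine h.trans (ENNReal.ofReal_le_ofReal ?_)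
  have h1 : Var[entrySum (devCoeff i z); gaussianMatrix m n] ≤ lam ^ 2 :=
    (variance_dev_le hm i z).trans (pow_le_pow_left₀ (Real.sqrt_nonneg _) hz 2)
  rw [div_le_div_iff₀ (by positivity) (by norm_num)]
  linarith

/-- The event that some row is small against the point of the sequence selected by `rowSum`. -/
def smallRowEvent (lam : ℝ) (z : ℕ → Fin n → ℝ) (B : ℕ → Set (Fin n → ℝ)) (i : Fin m) :
    Set (Fin m → Fin n → ℝ) :=
  ⋃ k, (rowSum ⁻¹' B k ∩ {A | |ip (A i) (z k)| ≤ 2 * lam})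

lemma measurableSet_smallRowEvent {z : ℕ → Fin n → ℝ} {B : ℕ → Set (Fin n → ℝ)}
    (hB : ∀ k, MeasurableSet (B k)) (i : Fin m) : MeasurableSet (smallRowEvent lam z B i) :=
  MeasurableSet.iUnion fun k => (measurable_rowSum (hB k)).inter
    (isClosed_le ((continuous_ip (z k)).comp (continuous_apply i)).abs
      continuous_const).measurableSet

lemma measure_smallRowEvent_le (hm : m ≠ 0) (hlam : 0 < lam) {z : ℕ → Fin n → ℝ}
    (hz : ∀ k, enorm2 (z k) ≤ lam) {B : ℕ → Set (Fin n → ℝ)} (hB : ∀ k, MeasurableSet (B k))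
    (hdisj : Pairwise (Function.onFun Disjoint B))
    (hBz : ∀ k, ∀ g ∈ B k, 22 * lam * √m < |ip g (z k)|) (i : Fin m) :
    gaussianMatrix m n (smallRowEvent lam z B i) ≤ ENNReal.ofReal (1 / 400) := by
  have hsm : (0 : ℝ) < √m := by
    have : (0 : ℝ) < m := by positivity
    positivity
  calc gaussianMatrix m n (smallRowEvent lam z B i)
      ≤ ∑' k, gaussianMatrix m n (rowSum ⁻¹' B k ∩ {A | |ip (A i) (z k)| ≤ 2 * lam}) :=
        measure_iUnion_le _
    _ ≤ ∑' k, gaussianMatrix m n (rowSum ⁻¹' B k) * ENNReal.ofReal (1 / 400) := by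
        refine ENNReal.tsum_le_tsum fun k => ?_
        have hsub : rowSum ⁻¹' B k ∩ {A | |ip (A i) (z k)| ≤ 2 * lam} ⊆
            rowSum ⁻¹' B k ∩ entrySum (devCoeff i (z k)) ⁻¹' {x | 20 * lam ≤ |x|} := by
          rintro A ⟨h1, h2⟩
          refine ⟨h1, ?_⟩
          have h3 := hBz k _ h1
          have h4 : |ip (A i) (z k)| ≤ 2 * lam := h2
          change 20 * lam ≤ |entrySum (devCoeff i (z k)) A|
          rw [entrySum_devCoeff]
          have h5 : 22 * lam ≤ |(√m)⁻¹ * ip (rowSum A) (z k)| := by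
            rw [abs_mul, abs_of_pos (inv_pos.2 hsm), ← div_eq_inv_mul, le_div_iff₀ hsm]
            exact h3.le
          have h6 := abs_sub_abs_le_abs_sub ((√m)⁻¹ * ip (rowSum A) (z k)) (ip (A i) (z k))
          rw [abs_sub_comm] at h6
          linarith
        refine (measure_mono hsub).trans ?_
        rw [(indepFun_rowSum_dev hm i (z k)).measure_inter_preimage_eq_mul _ _ (hB k)
          (isClosed_le continuous_const continuous_abs).measurableSet]
        gcongr
        exact measure_dev_ge_le hm hlam i (hz k)
    _ = gaussianMatrix m n (⋃ k, rowSum ⁻¹' B k) * ENNReal.ofReal (1 / 400) := by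
        rw [ENNReal.tsum_mul_right, measure_iUnion
          (fun a b hab => (hdisj hab).preimage _) fun k => measurable_rowSum (hB k)]
    _ ≤ 1 * ENNReal.ofReal (1 / 400) := by gcongr; exact prob_le_one
    _ = _ := one_mul _

open Classical in
/-- If the mean width of `V` is large, then with probability at least `0.15` some point of `V`
has a large inner product with at least nine tenths of the rows. -/
lemma exists_measurableSet_large_rows (hm : m ≠ 0) (hlam : 0 < lam) {V : Set (Fin n → ℝ)}
    (hne : V.Nonempty) (hV : ∀ t ∈ V, enorm2 t ≤ lam)
    (h : 4 * (22 * lam * √m) < meanWidth V) :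
    ∃ S : Set (Fin m → Fin n → ℝ), MeasurableSet S ∧ 0.15 ≤ (gaussianMatrix m n).real S ∧
      ∀ A ∈ S, ∃ z ∈ V,
        ((Finset.univ.filter fun i => |ip (A i) z| ≤ 2 * lam).card : ℝ) < m / 10 := by
  obtain ⟨z, hz, hz2⟩ := exists_seq_measure_ge hne hV (by positivity) h
  set C : ℕ → Set (Fin n → ℝ) := fun k => {g | 22 * lam * √m < |ip g (z k)|} with hC
  have hCm : ∀ k, MeasurableSet (C k) := fun k =>
    (isOpen_lt continuous_const (continuous_ip (z k)).abs).measurableSet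
  set B := disjointed C
  have hBm : ∀ k, MeasurableSet (B k) := fun k => MeasurableSet.disjointed hCm k
  set bad := fun i : Fin m => smallRowEvent lam z B i
  have hbadm : ∀ i, MeasurableSet (bad i) := fun i => measurableSet_smallRowEvent hBm i
  have hbad : ∀ i, (gaussianMatrix m n).real (bad i) ≤ 1 / 400 := fun i =>
    ENNReal.toReal_le_of_le_ofReal (by norm_num)
      (measure_smallRowEvent_le hm hlam (fun k => hV _ (hz k)) hBm (disjoint_disjointed C)
        (fun k g hg => disjointed_le C k hg) i)
  set N : (Fin m → Fin n → ℝ) → ℝ := fun A => ∑ i, (bad i).indicator 1 A with hN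
  have hNi : ∀ i ∈ Finset.univ,
      Integrable ((bad i).indicator (1 : (Fin m → Fin n → ℝ) → ℝ)) (gaussianMatrix m n) :=
    fun i _ => (integrable_const (1 : ℝ)).indicator (hbadm i)
  have hNm : Measurable N := Finset.measurable_fun_sum _ fun i _ =>
    measurable_one.indicator (hbadm i)
  have hNint : ∫ A, N A ∂(gaussianMatrix m n) ≤ m * (1 / 400) := by
    rw [hN, integral_finsetSum _ hNi]
    simp only [integral_indicator_one (hbadm _)]
    exact (Finset.sum_le_card_nsmul _ _ _ fun i _ => hbad i).trans (by simp)
  have hm0 : (0 : ℝ) < m := by positivity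
  set M : Set (Fin m → Fin n → ℝ) := {A | (m : ℝ) / 10 ≤ N A}
  have hM : (gaussianMatrix m n).real M ≤ 0.025 := by
    have := mul_meas_ge_le_integral_of_nonneg (μ := gaussianMatrix m n) (f := N)
      (ae_of_all _ fun A => Finset.sum_nonneg fun i _ =>
        Set.indicator_nonneg (fun _ _ => zero_le_one) _)
      (integrable_finsetSum _ hNi) ((m : ℝ) / 10)
    have h2 := this.trans hNint
    have h3 : (m : ℝ) * ((gaussianMatrix m n).real M / 10) ≤ m * (1 / 400) := by
      refine le_trans (le_of_eq ?_) h2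
      rw [mul_div_assoc', div_mul_eq_mul_div]
    have := le_of_mul_le_mul_left h3 hm0
    linarith
  have hMm : MeasurableSet M := measurableSet_le measurable_const hNm
  have hU : 0.2 ≤ (gaussianMatrix m n).real (rowSum ⁻¹' ⋃ k, C k) := by
    rwa [← map_measureReal_apply measurable_rowSum (MeasurableSet.iUnion hCm), map_rowSum hm]
  refine ⟨(rowSum ⁻¹' ⋃ k, C k) \ M, (measurable_rowSum (MeasurableSet.iUnion hCm)).diff hMm,
    ?_, ?_⟩
  · have := le_measureReal_sdiff (μ := gaussianMatrix m n) (s₁ := rowSum ⁻¹' ⋃ k, C k) (s₂ := M)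
    linarith
  · rintro A ⟨hA, hAM⟩
    rw [← iUnion_disjointed] at hA
    obtain ⟨k, hk⟩ := Set.mem_iUnion.1 hA
    refine ⟨z k, hz k, lt_of_le_of_lt ?_ (not_le.1 hAM)⟩
    rw [Finset.card_filter]
    push_cast
    refine Finset.sum_le_sum fun i _ => ?_
    split_ifs with hi
    · have : A ∈ bad i := Set.mem_iUnion.2 ⟨k, hk, hi⟩
      simp [this]
    · exact Set.indicator_nonneg (fun _ _ => zero_le_one) _

end LargeRows

section Geometry

variable {m n : ℕ}

lemma ip_mulVecR (A : Fin m → Fin n → ℝ) (x : Fin n → ℝ) (i : Fin m) :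
    mulVecR A x i = ip (A i) x := rfl

/-- Half of a difference of points of a symmetric convex set belongs to it, with its opposite. -/
lemma half_mem_of_mem_diffSet {T : Set (Fin n → ℝ)} (hT : Convex ℝ T) (hsymm : ∀ x ∈ T, -x ∈ T)
    {z : Fin n → ℝ} (hz : z ∈ diffSet T) : (1 / 2 : ℝ) • z ∈ T ∧ -((1 / 2 : ℝ) • z) ∈ T := by
  obtain ⟨a, ha, b, hb, rfl⟩ := hz
  have h : (1 / 2 : ℝ) • (a - b) ∈ T := by
    have := hT ha (hsymm b hb) (by norm_num : (0 : ℝ) ≤ 1 / 2) (by norm_num : (0 : ℝ) ≤ 1 / 2)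
      (by norm_num)
    convert this using 1
    module
  exact ⟨h, hsymm _ h⟩

lemma signPM_ne_of_abs_lt {u v τ : ℝ} (hτ : |τ| < |u|) (hv : v = -u) :
    signPM (u + τ) ≠ signPM (v + τ) := by
  subst hv
  unfold signPM
  rcases abs_cases u with ⟨h1, h2⟩ | ⟨h1, h2⟩ <;> rcases abs_cases τ with ⟨h3, h4⟩ | ⟨h3, h4⟩ <;>
    split_ifs <;> linarith

open Classical in
lemma le_hamming_half {A : Fin m → Fin n → ℝ} {τ : Fin m → ℝ} {lam : ℝ} (hτ : ∀ i, |τ i| ≤ lam)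
    (z : Fin n → ℝ) :
    (m : ℝ) - ((Finset.univ.filter fun i => |ip (A i) z| ≤ 2 * lam).card : ℝ) ≤
      hamming (signVec (mulVecR A ((1 / 2 : ℝ) • z) + τ))
        (signVec (mulVecR A (-((1 / 2 : ℝ) • z)) + τ)) := by
  have h1 := Finset.card_filter_add_card_filter_not (s := (Finset.univ : Finset (Fin m)))
    (fun i => |ip (A i) z| ≤ 2 * lam)
  rw [Finset.card_univ, Fintype.card_fin] at h1
  have h2 : (Finset.univ.filter fun i => ¬ |ip (A i) z| ≤ 2 * lam).card ≤
      hamming (signVec (mulVecR A ((1 / 2 : ℝ) • z) + τ))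
        (signVec (mulVecR A (-((1 / 2 : ℝ) • z)) + τ)) := by
    unfold hamming
    refine Finset.card_le_card fun i hi => ?_
    simp only [Finset.mem_filter, Finset.mem_univ, true_and, not_le] at hi ⊢
    refine signPM_ne_of_abs_lt ?_ ?_
    · rw [ip_mulVecR, ip_smul_right, abs_mul, abs_of_pos (by norm_num : (0 : ℝ) < 1 / 2)]
      linarith [hτ i]
    · rw [ip_mulVecR, ip_mulVecR, ← neg_smul, ip_smul_right, ip_smul_right]
      ring
  rw [← Nat.cast_le (α := ℝ)] at h2
  rw [← Nat.cast_inj (R := ℝ), Nat.cast_add] at h1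
  linarith

lemma unifCube_univ (m : ℕ) {lam : ℝ} (hlam : 0 < lam) : unifCube m lam Set.univ = 1 := by
  have h : (volume : Measure (Fin m → ℝ)) (Set.univ.pi fun _ => Set.Icc (-lam) lam)
      = ENNReal.ofReal ((2 * lam) ^ m) := by
    rw [volume_pi_pi]
    simp only [Real.volume_Icc, Finset.prod_const, Finset.card_univ, Fintype.card_fin]
    rw [ENNReal.ofReal_pow (by positivity)]
    congr 2
    ring
  simp only [unifCube, Measure.smul_apply, Measure.restrict_apply_univ, h, smul_eq_mul]
  exact ENNReal.inv_mul_cancel (by simpa using by positivity) ENNReal.ofReal_ne_top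

lemma unifCube_ae (m : ℕ) (lam : ℝ) : ∀ᵐ τ ∂(unifCube m lam), ∀ i, |τ i| ≤ lam := by
  refine Measure.ae_smul_measure ?_ _
  filter_upwards [ae_restrict_mem (MeasurableSet.univ_pi fun _ => measurableSet_Icc)] with τ hτ i
  exact abs_le.2 (hτ i trivial)

end Geometry

/-- Lemma 4.3: the lower bound on the shift parameter λ. -/
theorem lower_bound_on_lambda :
    ∃ c : ℝ, 0 < c ∧ ∀ β : ℝ, 0 < β → ∃ γ : ℝ, 1 ≤ γ ∧
      ∀ (n m : ℕ) (T : Set (Fin n → ℝ)) (δ lam : ℝ),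
        Convex ℝ T → (∀ x ∈ T, -x ∈ T) → (interior T).Nonempty →
        0 < δ → 0 < lam →
        meanWidth (diffSet T ∩ ballE n lam) > γ * meanWidth (diffSet T ∩ ballE n δ) →
        ENNReal.ofReal 0.9 ≤
          ((gaussianMatrix m n).prod (unifCube m lam))
            {p | ∀ x ∈ T, ∀ y ∈ T,
              |Real.sqrt (2 * Real.pi) * lam / m *
                  (hamming (signVec (mulVecR p.1 x + p.2)) (signVec (mulVecR p.1 y + p.2)) : ℝ)
                - enorm2 (x - y)| ≤ δ} →
        β * lam * Real.sqrt m ≥ meanWidth (diffSet T ∩ ballE n δ) := by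
  classical
  refine ⟨1, one_pos, fun β hβ => ⟨max 1 (88 / β), le_max_left _ _, ?_⟩⟩
  intro n m T δ lam hT hsymm hint hδ hlam hmw hE
  set V := diffSet T ∩ ballE n lam
  set W := diffSet T ∩ ballE n δ
  obtain ⟨a, ha⟩ := hint.mono interior_subset
  have h0 : (0 : Fin n → ℝ) ∈ diffSet T := ⟨a, ha, a, ha, (sub_self a).symm⟩
  have h0r : ∀ r : ℝ, 0 < r → (0 : Fin n → ℝ) ∈ ballE n r := fun r hr => by
    simp [ballE, enorm2, hr.le]
  have hVne : V.Nonempty := ⟨0, h0, h0r lam hlam⟩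
  have hWne : W.Nonempty := ⟨0, h0, h0r δ hδ⟩
  have hW0 : 0 ≤ meanWidth W := meanWidth_nonneg hWne fun t ht => ht.2
  have hnot : ¬ V ⊆ W := fun h => by
    have h1 : meanWidth V ≤ meanWidth W := meanWidth_mono hVne (fun t ht => ht.2) h
    nlinarith [le_max_left 1 (88 / β)]
  have hδlam : δ < lam := by
    by_contra hle
    exact hnot fun z hz => ⟨hz.1, le_trans hz.2 (not_lt.1 hle)⟩
  have hm : m ≠ 0 := by
    rintro rfl
    refine hnot fun z hz => ⟨hz.1, ?_⟩
    obtain ⟨p, hp⟩ := nonempty_of_measure_ne_zero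
      (lt_of_lt_of_le (ENNReal.ofReal_pos.2 (by norm_num)) hE).ne'
    obtain ⟨x, hx, y, hy, rfl⟩ := hz.1
    have := hp x hx y hy
    simp only [Nat.cast_zero, div_zero, zero_mul, zero_sub, abs_neg] at this
    exact (le_abs_self _).trans this
  by_contra hlt
  have hlt : β * lam * √m < meanWidth W := not_le.1 hlt
  have hbig : 4 * (22 * lam * √m) < meanWidth V := by
    have h1 : 88 / β * (β * lam * √m) ≤ 88 / β * meanWidth W := by gcongr
    have h2 : 88 / β * meanWidth W ≤ max 1 (88 / β) * meanWidth W := by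
      gcongr
      exact le_max_right _ _
    have h3 : 88 / β * (β * lam * √m) = 4 * (22 * lam * √m) := by
      field_simp
      ring
    linarith
  obtain ⟨S, hSm, hS, hSV⟩ :=
    exists_measurableSet_large_rows hm hlam hVne (fun t ht => ht.2) hbig
  have hpi : (2.5 : ℝ) ≤ √(2 * π) := by
    apply Real.le_sqrt_of_sq_le
    linarith [Real.pi_gt_d2]
  have hm0 : (0 : ℝ) < m := by positivity
  have hτ : ∀ᵐ p ∂((gaussianMatrix m n).prod (unifCube m lam)), ∀ i, |p.2 i| ≤ lam :=
    Measure.quasiMeasurePreserving_snd.ae (unifCube_ae m lam)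
  have hle := hE.trans (measure_mono_ae (t := Sᶜ ×ˢ Set.univ) (hτ.mono fun p hp hpE => by
    refine Set.mk_mem_prod (fun hpS => ?_) trivial
    obtain ⟨z, hz, hcard⟩ := hSV p.1 hpS
    obtain ⟨h1, h2⟩ := half_mem_of_mem_diffSet hT hsymm hz.1
    have h3 := hpE _ h1 _ h2
    have h4 := le_hamming_half (A := p.1) hp z
    have h5 : (1 / 2 : ℝ) • z - -((1 / 2 : ℝ) • z) = z := by module
    rw [h5] at h3
    have h6 := (abs_le.1 h3).2
    have h7 : enorm2 z ≤ lam := hz.2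
    have h8 : 2.5 * lam / m * (9 / 10 * m) ≤ √(2 * π) * lam / m *
        hamming (signVec (mulVecR p.1 ((1 / 2 : ℝ) • z) + p.2))
          (signVec (mulVecR p.1 (-((1 / 2 : ℝ) • z)) + p.2)) := by
      gcongr
      linarith
    have h9 : 2.5 * lam / m * (9 / 10 * m) = 2.25 * lam := by
      field_simp
      norm_num
    linarith))
  rw [Measure.prod_prod, unifCube_univ m hlam, mul_one,
    ← ofReal_measureReal, ENNReal.ofReal_le_ofReal_iff measureReal_nonneg,
    probReal_compl_eq_one_sub hSm] at hle
  linarith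

end
end
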